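/- Let n ≥ 1, ε > 0, let x = Σ_{k∈F} c_k e_k be an (n,ε) basic special convex combination, and let G ⊆ F. Then ‖Σ_{k∈G} c_k e_k‖_T ≤ (1/2ⁿ) Σ_{k∈G} c_k + ε, where ‖·‖_T is the Tsirelson norm determined by the norming set W_T′. -/

import Mathlib

/-- The successor operation for Schreier families: `F` belongs to the successor of `S`
if `F` is empty or `F = F₁ ∪ ⋯ ∪ F_k` with `F₁ < ⋯ < F_k`, each `F_j ∈ S`,
and `k ≤ min F₁`. -/
def SchreierSucc (S : Set (Finset ℕ)) : Set (Finset ℕ) :=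
  {F | F = ∅ ∨ ∃ (k : ℕ) (hk : 0 < k) (G : Fin k → Finset ℕ),
    (∀ i, G i ∈ S) ∧ (∀ i, (G i).Nonempty) ∧
    (∀ i j : Fin k, i < j → ∀ a ∈ G i, ∀ b ∈ G j, a < b) ∧
    (∀ a ∈ G ⟨0, hk⟩, k ≤ a) ∧
    F = Finset.univ.biUnion G}

/-- The Schreier families `𝒮ₙ`, as families of finite subsets of the positive integers:
`𝒮₀` consists of the empty set and the singletons of positive integers,
`𝒮₁ = {F : #F ≤ min F}` (together with the empty set), and
`𝒮ₙ₊₁` is obtained from `𝒮ₙ` by the successor operation. -/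
def Schreier : ℕ → Set (Finset ℕ)
  | 0 => {F | F = ∅ ∨ ∃ n : ℕ, 0 < n ∧ F = {n}}
  | 1 => {F | ∀ a ∈ F, F.card ≤ a}
  | n + 2 => SchreierSucc (Schreier (n + 1))


open scoped Classical

/-- A finite sequence `f 0 < f 1 < ⋯ < f (d-1)` of finitely supported vectors is
`𝒮ₙ`-admissible: all supports are nonempty and successive, and the set of minima of the
supports (witnessed by `μ`) belongs to the Schreier family `𝒮ₙ`. -/
def SAdmissible (n : ℕ) {d : ℕ} (f : Fin d → (ℕ →₀ ℝ)) : Prop :=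
  (∀ i, (f i).support.Nonempty) ∧
  (∀ i j : Fin d, i < j → ∀ a ∈ (f i).support, ∀ b ∈ (f j).support, a < b) ∧
  ∃ μ : Fin d → ℕ, (∀ i, μ i ∈ (f i).support ∧ ∀ a ∈ (f i).support, μ i ≤ a) ∧
    Finset.image μ Finset.univ ∈ Schreier n

/-- The restriction `Ef` of a finitely supported vector `f` to a set `E ⊆ ℕ`:
`(Ef)(k) = f(k)` for `k ∈ E` and `0` otherwise. -/
noncomputable def restrictTo (E : Set ℕ) (f : ℕ →₀ ℝ) : ℕ →₀ ℝ :=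
  Finsupp.filter (· ∈ E) f

/-- The Tsirelson norming set `W_T′`: the smallest subset of `c₀₀` containing `±eₙ` for every
positive integer `n`, closed under restrictions to subsets of `ℕ`, and such that for every
`𝒮₁`-admissible sequence `f₁ < ⋯ < f_d` in `W_T′` the functional `(1/2)(f₁ + ⋯ + f_d)`
belongs to `W_T′`. -/
inductive TsirelsonW : (ℕ →₀ ℝ) → Prop
  | unit_pos (n : ℕ) (hn : 0 < n) : TsirelsonW (Finsupp.single n 1)
  | unit_neg (n : ℕ) (hn : 0 < n) : TsirelsonW (-Finsupp.single n 1)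
  | restrict (E : Set ℕ) (f : ℕ →₀ ℝ) (hf : TsirelsonW f) : TsirelsonW (restrictTo E f)
  | node (d : ℕ) (hd : 0 < d) (f : Fin d → (ℕ →₀ ℝ)) (hf : ∀ i, TsirelsonW (f i))
      (hadm : SAdmissible 1 f) : TsirelsonW ((1 / 2 : ℝ) • ∑ i, f i)

/-- The vector `x = Σ_{k∈F} c_k e_k` is an `(n,ε)` basic special convex combination:
`F ∈ 𝒮ₙ`, the coefficients `c_k` are nonnegative and sum to `1` over `F`, and every
subset `G ⊆ F` with `G ∈ 𝒮ₙ₋₁` satisfies `Σ_{k∈G} c_k < ε`. -/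
def IsBasicSCC (n : ℕ) (ε : ℝ) (F : Finset ℕ) (c : ℕ → ℝ) : Prop :=
  F ∈ Schreier n ∧ (∀ k ∈ F, 0 ≤ c k) ∧ (∑ k ∈ F, c k = 1) ∧
    ∀ G ⊆ F, G ∈ Schreier (n - 1) → ∑ k ∈ G, c k < ε

/-- The Tsirelson norm on `c₀₀`: `‖x‖_T = sup { Σ_k f(k) x(k) : f ∈ W_T′ }`. -/
noncomputable def tsirelsonNorm (x : ℕ →₀ ℝ) : ℝ :=
  sSup {r : ℝ | ∃ f : ℕ →₀ ℝ, TsirelsonW f ∧ r = x.sum fun k v => f k * v}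

theorem schreier_combine (m d : ℕ) (G : Fin d → Finset ℕ) (hS : ∀ i, G i ∈ Schreier m)
    (hlt : ∀ i j : Fin d, i < j → ∀ a ∈ G i, ∀ b ∈ G j, a < b)
    (hd : ∀ i, ∀ a ∈ G i, d ≤ a) : Finset.univ.biUnion G ∈ Schreier (m + 1) := by
  cases m with
  | zero =>
    intro a ha
    obtain ⟨i, -, hi⟩ := Finset.mem_biUnion.1 ha
    have hc : (Finset.univ.biUnion G).card ≤ (Finset.univ : Finset (Fin d)).card * 1 := by
      apply Finset.card_biUnion_le_card_mul
      intro j _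
      rcases hS j with h | ⟨n, -, h⟩ <;> simp [h]
    have := hd i a hi
    simp at hc
    omega
  | succ m =>
    let T : Finset (Fin d) := Finset.univ.filter fun i => (G i).Nonempty
    by_cases hT : T.card = 0
    · left
      rw [Finset.card_eq_zero, Finset.filter_eq_empty_iff] at hT
      apply Finset.eq_empty_of_forall_notMem
      intro a ha
      obtain ⟨i, -, hi⟩ := Finset.mem_biUnion.1 ha
      exact hT (Finset.mem_univ i) ⟨a, hi⟩
    · right
      have hTd : T.card ≤ d := by simpa using Finset.card_le_univ T
      refine ⟨T.card, Nat.pos_of_ne_zero hT, fun i => G (T.orderEmbOfFin rfl i),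
        fun i => hS _, fun i => ?_, fun i j hij => hlt _ _ ?_, fun a ha => ?_, ?_⟩
      · exact (Finset.mem_filter.1 (T.orderEmbOfFin_mem rfl i)).2
      · exact (T.orderEmbOfFin rfl).strictMono hij
      · exact hTd.trans (hd _ a ha)
      · ext a
        simp only [Finset.mem_biUnion, Finset.mem_univ, true_and]
        constructor
        · rintro ⟨i, hi⟩
          have hiT : i ∈ T := Finset.mem_filter.2 ⟨Finset.mem_univ _, ⟨a, hi⟩⟩
          have : i ∈ Set.range (T.orderEmbOfFin rfl) := by
            rw [Finset.range_orderEmbOfFin]; exact hiT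
          obtain ⟨j, rfl⟩ := this
          exact ⟨j, hi⟩
        · rintro ⟨j, hj⟩
          exact ⟨_, hj⟩

theorem schreier_hered (m : ℕ) : ∀ F ∈ Schreier m, ∀ H ⊆ F, H ∈ Schreier m := by
  induction m with
  | zero =>
    intro F hF H hH
    rcases hF with rfl | ⟨n, hn, rfl⟩
    · exact Or.inl (Finset.subset_empty.1 hH)
    · rcases Finset.subset_singleton_iff.1 hH with h | h
      · exact Or.inl h
      · exact Or.inr ⟨n, hn, h⟩
  | succ m ih =>
    cases m with
    | zero =>
      intro F hF H hH a ha
      exact (Finset.card_le_card hH).trans (hF a (hH ha))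
    | succ m =>
      intro F hF H hH
      rcases hF with rfl | ⟨k, hk, G, hS, hne, hlt, hmin, rfl⟩
      · exact Or.inl (Finset.subset_empty.1 hH)
      · have h := schreier_combine (m + 1) k (fun i => G i ∩ H)
          (fun i => ih _ (hS i) _ Finset.inter_subset_left)
          (fun i j hij a ha b hb => hlt i j hij a (Finset.mem_inter.1 ha).1 b
            (Finset.mem_inter.1 hb).1)
          (fun i a ha => by
            have ha := (Finset.mem_inter.1 ha).1
            obtain ⟨b, hb⟩ := hne ⟨0, hk⟩
            by_cases hi : i = ⟨0, hk⟩
            · subst hi; exact hmin a ha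
            · have h0 : (⟨0, hk⟩ : Fin k) < i := by
                rw [Fin.lt_def]
                have : i.val ≠ 0 := fun h => hi (Fin.ext h)
                simp only
                omega
              exact (hmin b hb).trans (hlt _ _ h0 b hb a ha).le)
        have e : H = Finset.univ.biUnion fun i => G i ∩ H := by
          ext a
          simp only [Finset.mem_biUnion, Finset.mem_inter, Finset.mem_univ, true_and]
          constructor
          · intro ha
            obtain ⟨i, -, hi⟩ := Finset.mem_biUnion.1 (hH ha)
            exact ⟨i, hi, ha⟩
          · rintro ⟨i, -, ha⟩; exact ha
        rw [e]; exact h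

theorem schreier_singleton (m n : ℕ) (hn : 0 < n) : ({n} : Finset ℕ) ∈ Schreier m := by
  induction m with
  | zero => exact Or.inr ⟨n, hn, rfl⟩
  | succ m ih =>
    have h := schreier_combine m 1 (fun _ => {n}) (fun _ => ih)
      (fun i j hij => absurd hij (by simp [Subsingleton.elim i j]))
      (fun i a ha => by rw [Finset.mem_singleton.1 ha]; exact hn)
    simpa using h

theorem sum_apply_eq {d : ℕ} (f : Fin d → (ℕ →₀ ℝ))
    (hlt : ∀ i j : Fin d, i < j → ∀ a ∈ (f i).support, ∀ b ∈ (f j).support, a < b)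
    (i : Fin d) (k : ℕ) (hi : f i k ≠ 0) : (∑ j, f j) k = f i k := by
  rw [Finsupp.finsetSum_apply]
  apply Finset.sum_eq_single i
  · intro j _ hj
    by_contra h
    rcases lt_or_gt_of_ne hj with h1 | h1
    · exact lt_irrefl k (hlt _ _ h1 k (Finsupp.mem_support_iff.2 h) k (Finsupp.mem_support_iff.2 hi))
    · exact lt_irrefl k (hlt _ _ h1 k (Finsupp.mem_support_iff.2 hi) k (Finsupp.mem_support_iff.2 h))
  · intro h; exact absurd (Finset.mem_univ i) h

theorem W_key (f : ℕ →₀ ℝ) (hf : TsirelsonW f) : (∀ k, |f k| ≤ 1) ∧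
    ∀ m, f.support.filter (fun k => (1 / 2 : ℝ) ^ (m + 1) < |f k|) ∈ Schreier m := by
  induction hf with
  | unit_pos n hn =>
    refine ⟨fun k => ?_, fun m => schreier_hered m _ (schreier_singleton m n hn) _ ?_⟩
    · rw [Finsupp.single_apply]; split_ifs <;> simp
    · exact (Finset.filter_subset _ _).trans Finsupp.support_single_subset
  | unit_neg n hn =>
    refine ⟨fun k => ?_, fun m => schreier_hered m _ (schreier_singleton m n hn) _ ?_⟩
    · rw [Finsupp.neg_apply, Finsupp.single_apply]; split_ifs <;> simp
    · refine (Finset.filter_subset _ _).trans ?_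
      rw [Finsupp.support_neg]
      exact Finsupp.support_single_subset
  | restrict E f hf ih =>
    refine ⟨fun k => ?_, fun m => schreier_hered m _ (ih.2 m) _ ?_⟩
    · rw [restrictTo, Finsupp.filter_apply]
      split_ifs
      · exact ih.1 k
      · simp
    · intro k hk
      simp only [restrictTo, Finset.mem_filter, Finsupp.mem_support_iff,
        Finsupp.filter_apply] at hk ⊢
      by_cases h : k ∈ E <;> simp [h] at hk ⊢
      exact hk
  | node d hd f hf hadm ih =>
    obtain ⟨hne, hlt, μ, hμ, hS⟩ := hadm
    have hval : ∀ k, ((1 / 2 : ℝ) • ∑ i, f i) k ≠ 0 →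
        ∃ i, f i k ≠ 0 ∧ |((1 / 2 : ℝ) • ∑ i, f i) k| = 1 / 2 * |f i k| := by
      intro k hk
      have : ∃ i, f i k ≠ 0 := by
        by_contra! h
        apply hk
        simp [Finsupp.finsetSum_apply, h]
      obtain ⟨i, hi⟩ := this
      refine ⟨i, hi, ?_⟩
      rw [Finsupp.smul_apply, sum_apply_eq f hlt i k hi, smul_eq_mul, abs_mul]
      norm_num
    have hhalf : ∀ k, |((1 / 2 : ℝ) • ∑ i, f i) k| ≤ 1 / 2 := by
      intro k
      by_cases hk : ((1 / 2 : ℝ) • ∑ i, f i) k = 0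
      · rw [hk]; norm_num
      · obtain ⟨i, -, h⟩ := hval k hk
        rw [h]
        have := (ih i).1 k
        linarith
    have hinj : Function.Injective μ := by
      intro i j hij
      by_contra h
      rcases lt_or_gt_of_ne h with h1 | h1
      · have := hlt _ _ h1 _ (hμ i).1 _ (hμ j).1
        omega
      · have := hlt _ _ h1 _ (hμ j).1 _ (hμ i).1
        omega
    have hdle : ∀ i, ∀ a ∈ (f i).support, d ≤ a := by
      intro i a ha
      have h1 := hS (μ i) (Finset.mem_image_of_mem _ (Finset.mem_univ i))
      rw [Finset.card_image_of_injective _ hinj, Finset.card_univ, Fintype.card_fin] at h1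
      exact h1.trans ((hμ i).2 a ha)
    refine ⟨fun k => (hhalf k).trans (by norm_num), fun m => ?_⟩
    cases m with
    | zero =>
      left
      rw [Finset.filter_eq_empty_iff]
      intro k _
      have := hhalf k
      simp only [zero_add, pow_one, not_lt]
      exact this
    | succ m =>
      refine schreier_hered _ _ (schreier_combine m d
        (fun i => (f i).support.filter (fun k => (1 / 2 : ℝ) ^ (m + 1) < |f i k|))
        (fun i => (ih i).2 m)
        (fun i j hij a ha b hb => hlt i j hij a (Finset.mem_filter.1 ha).1 b
            (Finset.mem_filter.1 hb).1)
        (fun i a ha => hdle i a (Finset.mem_filter.1 ha).1)) _ ?_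
      intro k hk
      obtain ⟨hk0, hk1⟩ := Finset.mem_filter.1 hk
      obtain ⟨i, hi, h⟩ := hval k (Finsupp.mem_support_iff.1 hk0)
      rw [h, pow_succ] at hk1
      refine Finset.mem_biUnion.2 ⟨i, Finset.mem_univ i, Finset.mem_filter.2
        ⟨Finsupp.mem_support_iff.2 hi, ?_⟩⟩
      linarith

/-- Let `n ≥ 1`, `ε > 0`, let `x = Σ_{k∈F} c_k e_k` be an `(n,ε)` basic special convex
combination and let `G ⊆ F`. Then `‖Σ_{k∈G} c_k e_k‖_T ≤ (1/2ⁿ) Σ_{k∈G} c_k + ε`. -/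
theorem tsirelsonNorm_basic_scc_le (n : ℕ) (hn : 1 ≤ n) (ε : ℝ) (hε : 0 < ε)
    (F : Finset ℕ) (c : ℕ → ℝ) (hscc : IsBasicSCC n ε F c) (G : Finset ℕ) (hG : G ⊆ F) :
    tsirelsonNorm (∑ k ∈ G, Finsupp.single k (c k)) ≤ (1 / 2 ^ n) * ∑ k ∈ G, c k + ε := by
  obtain ⟨hF, hc, hsum, hsmall⟩ := hscc
  have hc' : ∀ k ∈ G, 0 ≤ c k := fun k hk => hc k (hG hk)
  have hs0 : 0 ≤ ∑ k ∈ G, c k := Finset.sum_nonneg hc'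
  apply Real.sSup_le _ (by positivity)
  rintro r ⟨f, hf, rfl⟩
  obtain ⟨h1, h2⟩ := W_key f hf
  have e : ((∑ k ∈ G, Finsupp.single k (c k)).sum fun k v => f k * v) = ∑ k ∈ G, f k * c k := by
    rw [← Finsupp.sum_finsetSum_index (by simp) (by intros; ring)]
    exact Finset.sum_congr rfl fun k _ => Finsupp.sum_single_index (by simp)
  rw [e]
  obtain ⟨m, rfl⟩ : ∃ m, n = m + 1 := ⟨n - 1, by omega⟩
  have hA : ∑ k ∈ G.filter (fun k => (1 / 2 : ℝ) ^ (m + 1) < |f k|), c k < ε := by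
    apply hsmall _ ((Finset.filter_subset _ _).trans hG)
    refine schreier_hered _ _ (h2 m) _ ?_
    intro k hk
    have hk1 := (Finset.mem_filter.1 hk).2
    refine Finset.mem_filter.2 ⟨Finsupp.mem_support_iff.2 fun h0 => ?_, hk1⟩
    rw [h0, abs_zero] at hk1
    exact absurd hk1 (not_lt.2 (by positivity))
  rw [Finset.sum_filter] at hA
  refine le_trans ?_ (add_le_add_right hA.le _)
  rw [Finset.mul_sum, ← Finset.sum_add_distrib]
  apply Finset.sum_le_sum
  intro k hk
  have hck := hc' k hk
  have hp : (1 : ℝ) / 2 ^ (m + 1) = (1 / 2) ^ (m + 1) := by rw [one_div_pow]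
  rw [hp]
  have hpos : (0 : ℝ) ≤ (1 / 2) ^ (m + 1) * c k := by positivity
  have hfa : f k * c k ≤ |f k| * c k := mul_le_mul_of_nonneg_right (le_abs_self _) hck
  split_ifs with h
  · have := mul_le_mul_of_nonneg_right (h1 k) hck
    linarith
  · have := mul_le_mul_of_nonneg_right (not_lt.1 h) hck
    linarith
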